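/- arXiv:1612.04015 — 2 statements merged into one kernel-verified Lean document; each statement's English description precedes it below -/
import Mathlib

section
/- Let f : ℝ³ → ℝ be a bounded C² function whose first and second partial derivatives are bounded. Then for every a ∈ ℝ³, lim_{λ→∞} λ²·∫_{ℝ³} (f(u) − f(a))·δ_{a,λ}(u)^{4/(2−γ)} du = (c₂/4)·Δ_{θ₀}f(a). -/
open MeasureTheory Real

/-- The standard bubble
`δ_{a,λ}(x,y,t) = c₀·λ^{2−γ}·[(1 + λ²((x−x_a)² + (y−y_a)²))² + λ⁴(t − t_a + 2(x_a y − x y_a))²]^{−(2−γ)/2}`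
on `ℝ³`. -/
noncomputable def bubble (γ c₀ : ℝ) (a : ℝ × ℝ × ℝ) (l : ℝ) (u : ℝ × ℝ × ℝ) : ℝ :=
  c₀ * l ^ (2 - γ) *
    ((1 + l ^ 2 * ((u.1 - a.1) ^ 2 + (u.2.1 - a.2.1) ^ 2)) ^ 2
        + l ^ 4 * (u.2.2 - a.2.2 + 2 * (a.1 * u.2.1 - u.1 * a.2.1)) ^ 2) ^ (-(2 - γ) / 2)

/-- The homogeneous (gauge) distance
`d(a_i,a_j) = [((x_i−x_j)² + (y_i−y_j)²)² + (t_i − t_j + 2x_j y_i − 2x_i y_j)²]^{1/4}`. -/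
noncomputable def gdist (ai aj : ℝ × ℝ × ℝ) : ℝ :=
  (((ai.1 - aj.1) ^ 2 + (ai.2.1 - aj.2.1) ^ 2) ^ 2
      + (ai.2.2 - aj.2.2 + 2 * aj.1 * ai.2.1 - 2 * ai.1 * aj.2.1) ^ 2) ^ ((1 : ℝ) / 4)

/-- The interaction quantity
`ε_ij = (λ_i/λ_j + λ_j/λ_i + λ_i λ_j d(a_i,a_j)²)^{−(2−γ)}`. -/
noncomputable def epsb (γ : ℝ) (ai aj : ℝ × ℝ × ℝ) (li lj : ℝ) : ℝ :=
  (li / lj + lj / li + li * lj * gdist ai aj ^ 2) ^ (-(2 - γ))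

/-- The Heisenberg vector field `X = ∂/∂x + 2y·∂/∂t`. -/
noncomputable def Xop (f : ℝ × ℝ × ℝ → ℝ) (p : ℝ × ℝ × ℝ) : ℝ :=
  fderiv ℝ f p (1, 0, 2 * p.2.1)

/-- The Heisenberg vector field `Y = ∂/∂y − 2x·∂/∂t`. -/
noncomputable def Yop (f : ℝ × ℝ × ℝ → ℝ) (p : ℝ × ℝ × ℝ) : ℝ :=
  fderiv ℝ f p (0, 1, -(2 * p.1))

/-- The sub-Laplacian `Δ_{θ₀} = (1/4)(X² + Y²)`. -/
noncomputable def subLap (f : ℝ × ℝ × ℝ → ℝ) (p : ℝ × ℝ × ℝ) : ℝ :=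
  (1 / 4) * (Xop (Xop f) p + Yop (Yop f) p)

/-- The constant `c₂ = 4·c₀^{4/(2−γ)}·∫ (x²+y²)/((1+x²+y²)²+t²)² dx dy dt`. -/
noncomputable def c2const (γ c₀ : ℝ) : ℝ :=
  4 * c₀ ^ (4 / (2 - γ)) *
    ∫ p : ℝ × ℝ × ℝ,
      (p.1 ^ 2 + p.2.1 ^ 2) / ((1 + p.1 ^ 2 + p.2.1 ^ 2) ^ 2 + p.2.2 ^ 2) ^ 2

/-- The profile `1/((1+x²+y²)²+t²)²` of the bubble raised to its critical power. -/
noncomputable def bubbleKernel (p : ℝ × ℝ × ℝ) : ℝ :=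
  1 / ((1 + p.1 ^ 2 + p.2.1 ^ 2) ^ 2 + p.2.2 ^ 2) ^ 2

lemma bubbleKernel_denom_pos (p : ℝ × ℝ × ℝ) :
    0 < (1 + p.1 ^ 2 + p.2.1 ^ 2) ^ 2 + p.2.2 ^ 2 := by positivity

lemma bubbleKernel_nonneg (p : ℝ × ℝ × ℝ) : 0 ≤ bubbleKernel p := by
  unfold bubbleKernel; positivity

lemma continuous_bubbleKernel : Continuous bubbleKernel := by
  unfold bubbleKernel
  exact Continuous.div (by fun_prop) (by fun_prop)
    fun p => (pow_pos (bubbleKernel_denom_pos p) 2).ne'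

lemma weighted_bubbleKernel_le (p : ℝ × ℝ × ℝ) :
    (1 + p.1 ^ 2 + p.2.1 ^ 2 + |p.2.2|) * bubbleKernel p ≤
      4 * ((1 + ‖p.1‖ ^ 2) ^ (-(3 / 2 : ℝ) / 2) *
        ((1 + ‖p.2.1‖ ^ 2) ^ (-(3 / 2 : ℝ) / 2) * (1 + ‖p.2.2‖) ^ (-(3 / 2 : ℝ)))) := by
  obtain ⟨x, y, t⟩ := p
  simp only [Real.norm_eq_abs, sq_abs]
  set S := 1 + x ^ 2 + y ^ 2 + |t| with hS
  have hS1 : 0 < S := by positivity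
  have hx : S ^ (-(3 / 2 : ℝ) / 2) ≤ (1 + x ^ 2) ^ (-(3 / 2 : ℝ) / 2) :=
    Real.rpow_le_rpow_of_nonpos (by positivity)
      (by rw [hS]; nlinarith [sq_nonneg y, abs_nonneg t]) (by norm_num)
  have hy : S ^ (-(3 / 2 : ℝ) / 2) ≤ (1 + y ^ 2) ^ (-(3 / 2 : ℝ) / 2) :=
    Real.rpow_le_rpow_of_nonpos (by positivity)
      (by rw [hS]; nlinarith [sq_nonneg x, abs_nonneg t]) (by norm_num)
  have ht : S ^ (-(3 / 2 : ℝ)) ≤ (1 + |t|) ^ (-(3 / 2 : ℝ)) :=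
    Real.rpow_le_rpow_of_nonpos (by positivity)
      (by rw [hS]; nlinarith [sq_nonneg x, sq_nonneg y]) (by norm_num)
  have hprod : S ^ (-(3 / 2 : ℝ) / 2) * (S ^ (-(3 / 2 : ℝ) / 2) * S ^ (-(3 / 2 : ℝ))) =
      1 / S ^ 3 := by
    rw [← Real.rpow_add hS1, ← Real.rpow_add hS1, one_div, ← Real.rpow_natCast,
      ← Real.rpow_neg hS1.le]
    norm_num
  have hK : S * bubbleKernel (x, y, t) ≤ 4 * (1 / S ^ 3) := by
    have hden : S ^ 2 / 2 ≤ (1 + x ^ 2 + y ^ 2) ^ 2 + t ^ 2 := by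
      rw [hS, ← sq_abs t]; nlinarith [sq_nonneg (1 + x ^ 2 + y ^ 2 - |t|)]
    have h4 : bubbleKernel (x, y, t) ≤ 1 / (S ^ 2 / 2) ^ 2 := by
      unfold bubbleKernel
      exact one_div_le_one_div_of_le (by positivity) (by gcongr)
    calc S * bubbleKernel (x, y, t) ≤ S * (1 / (S ^ 2 / 2) ^ 2) := by gcongr
      _ = 4 * (1 / S ^ 3) := by field_simp; norm_num
  refine hK.trans ?_
  rw [← hprod]
  gcongr

lemma integrable_weighted_bubbleKernel :
    Integrable fun p : ℝ × ℝ × ℝ => (1 + p.1 ^ 2 + p.2.1 ^ 2 + |p.2.2|) * bubbleKernel p := by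
  have h1 : Integrable fun x : ℝ => (1 + ‖x‖ ^ 2) ^ (-(3 / 2 : ℝ) / 2) :=
    integrable_rpow_neg_one_add_norm_sq (by norm_num)
  have h2 : Integrable fun x : ℝ => (1 + ‖x‖) ^ (-(3 / 2 : ℝ)) :=
    integrable_one_add_norm (by norm_num)
  refine ((h1.mul_prod (h1.mul_prod h2)).const_mul 4).mono' ?_ (.of_forall fun p => ?_)
  · exact (Continuous.mul (by fun_prop) continuous_bubbleKernel).aestronglyMeasurable
  · rw [Real.norm_of_nonneg (mul_nonneg (by positivity) (bubbleKernel_nonneg p))]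
    exact weighted_bubbleKernel_le p

lemma integrable_mul_bubbleKernel {g : ℝ × ℝ × ℝ → ℝ} (hg : Continuous g) {C : ℝ}
    (hC : ∀ p, |g p| ≤ C * (1 + p.1 ^ 2 + p.2.1 ^ 2 + |p.2.2|)) :
    Integrable fun p => g p * bubbleKernel p := by
  refine (integrable_weighted_bubbleKernel.const_mul C).mono'
    (hg.mul continuous_bubbleKernel).aestronglyMeasurable (.of_forall fun p => ?_)
  rw [norm_mul, Real.norm_of_nonneg (bubbleKernel_nonneg p), ← mul_assoc]
  exact mul_le_mul_of_nonneg_right (hC p) (bubbleKernel_nonneg p)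

lemma det_prod_prod (A : (ℝ × ℝ × ℝ) →ₗ[ℝ] ℝ × ℝ × ℝ) :
    LinearMap.det A = Matrix.det
      !![(A (1, 0, 0)).1, (A (0, 1, 0)).1, (A (0, 0, 1)).1;
        (A (1, 0, 0)).2.1, (A (0, 1, 0)).2.1, (A (0, 0, 1)).2.1;
        (A (1, 0, 0)).2.2, (A (0, 1, 0)).2.2, (A (0, 0, 1)).2.2] := by
  let e : (ℝ × ℝ × ℝ) ≃ₗ[ℝ] (Fin 3 → ℝ) :=
    { toFun := fun p => ![p.1, p.2.1, p.2.2]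
      invFun := fun v => (v 0, v 1, v 2)
      map_add' := fun p q => by ext i; fin_cases i <;> simp
      map_smul' := fun c p => by ext i; fin_cases i <;> simp
      left_inv := fun p => by simp
      right_inv := fun v => by ext i; fin_cases i <;> simp }
  rw [← LinearMap.det_toMatrix (Module.Basis.ofEquivFun e)]
  congr 1
  ext i j
  fin_cases i <;> fin_cases j <;>
    simp [LinearMap.toMatrix_apply, e]

instance : (volume : Measure (ℝ × ℝ × ℝ)).IsAddHaarMeasure :=
  haveI : (volume : Measure (ℝ × ℝ)).IsAddHaarMeasure := Measure.prod.instIsAddHaarMeasure _ _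
  Measure.prod.instIsAddHaarMeasure _ _

lemma integral_comp_linearMap (A : (ℝ × ℝ × ℝ) →ₗ[ℝ] ℝ × ℝ × ℝ) (hA : LinearMap.det A ≠ 0)
    {g : ℝ × ℝ × ℝ → ℝ} (hg : Continuous g) :
    ∫ p, g (A p) = |(LinearMap.det A)⁻¹| * ∫ p, g p := by
  have h := Measure.map_linearMap_addHaar_eq_smul_addHaar
    (volume : Measure (ℝ × ℝ × ℝ)) hA
  rw [← integral_map (φ := A) A.continuous_of_finiteDimensional.aemeasurable
    hg.aestronglyMeasurable, h, integral_smul_measure, ENNReal.toReal_ofReal (abs_nonneg _),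
    smul_eq_mul]

lemma integral_comp_neg_neg {g : ℝ × ℝ × ℝ → ℝ} (hg : Continuous g) :
    ∫ p : ℝ × ℝ × ℝ, g (-p.1, -p.2.1, p.2.2) = ∫ p, g p := by
  let A : (ℝ × ℝ × ℝ) →ₗ[ℝ] ℝ × ℝ × ℝ :=
    { toFun := fun p => (-p.1, -p.2.1, p.2.2)
      map_add' := fun p q => by ext <;> simp <;> ring
      map_smul' := fun c p => by ext <;> simp }
  have hdet : LinearMap.det A = 1 := by
    rw [det_prod_prod, Matrix.det_fin_three]; simp [A]
  have h := integral_comp_linearMap A (by simp [hdet]) hg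
  rw [hdet] at h
  simpa [A] using h

lemma integral_comp_neg_fst {g : ℝ × ℝ × ℝ → ℝ} (hg : Continuous g) :
    ∫ p : ℝ × ℝ × ℝ, g (-p.1, p.2.1, p.2.2) = ∫ p, g p := by
  let A : (ℝ × ℝ × ℝ) →ₗ[ℝ] ℝ × ℝ × ℝ :=
    { toFun := fun p => (-p.1, p.2.1, p.2.2)
      map_add' := fun p q => by ext <;> simp; ring
      map_smul' := fun c p => by ext <;> simp }
  have hdet : LinearMap.det A = -1 := by
    rw [det_prod_prod, Matrix.det_fin_three]; simp [A]
  have h := integral_comp_linearMap A (by simp [hdet]) hg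
  rw [hdet] at h
  simpa [A] using h

lemma integral_comp_neg_snd_snd {g : ℝ × ℝ × ℝ → ℝ} (hg : Continuous g) :
    ∫ p : ℝ × ℝ × ℝ, g (p.1, p.2.1, -p.2.2) = ∫ p, g p := by
  let A : (ℝ × ℝ × ℝ) →ₗ[ℝ] ℝ × ℝ × ℝ :=
    { toFun := fun p => (p.1, p.2.1, -p.2.2)
      map_add' := fun p q => by ext <;> simp; ring
      map_smul' := fun c p => by ext <;> simp }
  have hdet : LinearMap.det A = -1 := by
    rw [det_prod_prod, Matrix.det_fin_three]; simp [A]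
  have h := integral_comp_linearMap A (by simp [hdet]) hg
  rw [hdet] at h
  simpa [A] using h

lemma integral_comp_swap_fst_snd {g : ℝ × ℝ × ℝ → ℝ} (hg : Continuous g) :
    ∫ p : ℝ × ℝ × ℝ, g (p.2.1, p.1, p.2.2) = ∫ p, g p := by
  let A : (ℝ × ℝ × ℝ) →ₗ[ℝ] ℝ × ℝ × ℝ :=
    { toFun := fun p => (p.2.1, p.1, p.2.2)
      map_add' := fun p q => by ext <;> simp
      map_smul' := fun c p => by ext <;> simp }
  have hdet : LinearMap.det A = -1 := by
    rw [det_prod_prod, Matrix.det_fin_three]; simp [A]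
  have h := integral_comp_linearMap A (by simp [hdet]) hg
  rw [hdet] at h
  simpa [A] using h

lemma integral_comp_heisenberg (a : ℝ × ℝ × ℝ) {l : ℝ} (hl : 0 < l) {g : ℝ × ℝ × ℝ → ℝ}
    (hg : Continuous g) :
    ∫ p, g p = l⁻¹ ^ 4 * ∫ p : ℝ × ℝ × ℝ, g (a + l⁻¹ • (p.1, p.2.1, 2 * (a.2.1 * p.1 - a.1 * p.2.1))
      + l⁻¹ ^ 2 • (0, 0, p.2.2)) := by
  let A : (ℝ × ℝ × ℝ) →ₗ[ℝ] ℝ × ℝ × ℝ :=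
    { toFun := fun p => l⁻¹ • (p.1, p.2.1, 2 * (a.2.1 * p.1 - a.1 * p.2.1))
        + l⁻¹ ^ 2 • (0, 0, p.2.2)
      map_add' := fun p q => by ext <;> simp <;> ring
      map_smul' := fun c p => by ext <;> simp <;> ring }
  have hdet : LinearMap.det A = l⁻¹ ^ 4 := by
    rw [det_prod_prod, Matrix.det_fin_three]; simp [A]; ring
  have h := integral_comp_linearMap A (by rw [hdet]; positivity)
    (hg.comp (continuous_const_add a))
  simp only [Function.comp_def] at h
  rw [integral_add_left_eq_self g a, hdet, abs_of_nonneg (by positivity)] at h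
  have h' : ∫ p : ℝ × ℝ × ℝ, g (a + l⁻¹ • (p.1, p.2.1, 2 * (a.2.1 * p.1 - a.1 * p.2.1))
      + l⁻¹ ^ 2 • (0, 0, p.2.2)) = ∫ p, g (a + A p) := by
    simp only [A, LinearMap.coe_mk, AddHom.coe_mk, add_assoc]
  rw [h', h, ← mul_assoc, mul_inv_cancel₀ (by positivity), one_mul]

section Calculus

variable {E : Type*} [NormedAddCommGroup E] [NormedSpace ℝ E]

lemma abs_second_difference_le {f : E → ℝ} (hf : ContDiff ℝ 2 f) {C : ℝ}
    (hC : ∀ p, ‖fderiv ℝ (fderiv ℝ f) p‖ ≤ C) (b y : E) :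
    |f (b + y) + f (b - y) - 2 * f b| ≤ C * ‖y‖ ^ 2 := by
  have hd : Differentiable ℝ f := hf.differentiable (by norm_num)
  have hd2 : Differentiable ℝ (fderiv ℝ f) :=
    (hf.fderiv_right (m := 1) (by norm_num)).differentiable (by norm_num)
  have hlip : ∀ x : E, ‖fderiv ℝ f (x + y) - fderiv ℝ f x‖ ≤ C * ‖y‖ := fun x => by
    simpa using convex_univ.norm_image_sub_le_of_norm_fderiv_le (𝕜 := ℝ) (f := fderiv ℝ f)
      (fun z _ => hd2 z) (fun z _ => hC z) (Set.mem_univ x) (Set.mem_univ (x + y))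
  have hder : ∀ x, HasFDerivAt (fun x => f (x + y) - f x)
      (fderiv ℝ f (x + y) - fderiv ℝ f x) x := fun x =>
    ((hasFDerivAt_comp_add_right y).2 (hd (x + y)).hasFDerivAt).sub (hd x).hasFDerivAt
  have h := convex_univ.norm_image_sub_le_of_norm_hasFDerivWithin_le (𝕜 := ℝ)
      (f := fun x => f (x + y) - f x)
      (fun z _ => (hder z).hasFDerivWithinAt) (fun z _ => hlip z)
      (Set.mem_univ (b - y)) (Set.mem_univ b)
  rw [Real.norm_eq_abs] at h
  have e : f (b + y) - f b - (f (b - y + y) - f (b - y)) =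
      f (b + y) + f (b - y) - 2 * f b := by rw [sub_add_cancel]; ring
  rw [e] at h
  simpa [pow_two, mul_assoc] using h

lemma abs_parabolic_difference_le {f : E → ℝ} (hf : ContDiff ℝ 2 f) {C : ℝ}
    (hC1 : ∀ p, ‖fderiv ℝ f p‖ ≤ C) (hC2 : ∀ p, ‖fderiv ℝ (fderiv ℝ f) p‖ ≤ C)
    (a w v : E) (s : ℝ) :
    |f (a + s • w + s ^ 2 • v) + f (a + s • (-w) + s ^ 2 • v) - 2 * f a| ≤
      s ^ 2 * (C * (‖w‖ ^ 2 + 2 * ‖v‖)) := by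
  have hd : Differentiable ℝ f := hf.differentiable (by norm_num)
  have h1 := abs_second_difference_le hf hC2 (a + s ^ 2 • v) (s • w)
  have h2 : |f (a + s ^ 2 • v) - f a| ≤ C * ‖s ^ 2 • v‖ := by
    simpa using convex_univ.norm_image_sub_le_of_norm_fderiv_le (𝕜 := ℝ) (f := f)
      (fun z _ => hd z) (fun z _ => hC1 z) (Set.mem_univ a) (Set.mem_univ (a + s ^ 2 • v))
  rw [norm_smul, Real.norm_eq_abs, mul_pow, sq_abs] at h1
  rw [norm_smul, Real.norm_of_nonneg (sq_nonneg s)] at h2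
  have e1 : a + s • w + s ^ 2 • v = a + s ^ 2 • v + s • w := by abel
  have e2 : a + s • (-w) + s ^ 2 • v = a + s ^ 2 • v - s • w := by rw [smul_neg]; abel
  rw [e1, e2]
  rw [abs_le] at *
  constructor <;> nlinarith [h1.1, h1.2, h2.1, h2.2]

lemma tendsto_parabolic_difference {f : E → ℝ} (hf : ContDiff ℝ 2 f) (a w v : E) :
    Filter.Tendsto
      (fun s : ℝ => (f (a + s • w + s ^ 2 • v) + f (a + s • (-w) + s ^ 2 • v) - 2 * f a) / s ^ 2)
      (nhdsWithin 0 {0}ᶜ) (nhds (fderiv ℝ (fderiv ℝ f) a w w + 2 * fderiv ℝ f a v)) := by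
  have hd : Differentiable ℝ f := hf.differentiable (by norm_num)
  have hd2 : Differentiable ℝ (fderiv ℝ f) :=
    (hf.fderiv_right (m := 1) (by norm_num)).differentiable (by norm_num)
  have hc : ∀ (z : E) (s : ℝ),
      HasDerivAt (fun s : ℝ => a + s • z + s ^ 2 • v) (z + (2 * s) • v) s := fun z s => by
    have h1 := ((hasDerivAt_id s).smul_const z).const_add a
    have h2 := (hasDerivAt_pow 2 s).smul_const v
    have h := h1.add h2
    simp only [one_smul, Nat.cast_ofNat, Nat.add_one_sub_one, pow_one] at h
    exact h
  have hfc : ∀ (z : E) (s : ℝ), HasDerivAt (fun s : ℝ => f (a + s • z + s ^ 2 • v))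
      (fderiv ℝ f (a + s • z + s ^ 2 • v) (z + (2 * s) • v)) s := fun z s =>
    (hd _).hasFDerivAt.comp_hasDerivAt s (hc z s)
  have hfc2 : ∀ z : E, HasDerivAt
      (fun s : ℝ => fderiv ℝ f (a + s • z + s ^ 2 • v) (z + (2 * s) • v))
      (fderiv ℝ (fderiv ℝ f) a z z + 2 * fderiv ℝ f a v) 0 := fun z => by
    have h1 : HasDerivAt (fun s : ℝ => fderiv ℝ f (a + s • z + s ^ 2 • v))
        (fderiv ℝ (fderiv ℝ f) (a + (0 : ℝ) • z + (0 : ℝ) ^ 2 • v) (z + (2 * (0 : ℝ)) • v)) 0 :=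
      (hd2 _).hasFDerivAt.comp_hasDerivAt 0 (hc z 0)
    have h2 : HasDerivAt (fun s : ℝ => z + (2 * s) • v) ((2 : ℝ) • v) 0 := by
      simpa using (((hasDerivAt_id (0 : ℝ)).const_mul 2).smul_const v).const_add z
    simpa using h1.clm_apply h2
  have hp2 := (hfc2 w).add (hfc2 (-w))
  refine HasDerivAt.lhopital_zero_nhdsNE
    (f' := fun s => fderiv ℝ f (a + s • w + s ^ 2 • v) (w + (2 * s) • v) +
      fderiv ℝ f (a + s • (-w) + s ^ 2 • v) (-w + (2 * s) • v))
    (g' := fun s => 2 * s) ?_ ?_ ?_ ?_ ?_ ?_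
  · exact .of_forall fun s => ((hfc w s).add (hfc (-w) s)).sub_const _
  · exact .of_forall fun s => by simpa using hasDerivAt_pow 2 s
  · filter_upwards [self_mem_nhdsWithin] with s hs
    simpa using hs
  · have h := (((hfc w 0).add (hfc (-w) 0)).sub_const (2 * f a)).continuousAt.tendsto
    refine (h.mono_left nhdsWithin_le_nhds).trans_eq ?_
    simp [two_mul]
  · have h := (continuous_pow 2).tendsto (0 : ℝ)
    simpa using h.mono_left (nhdsWithin_le_nhds (s := {(0 : ℝ)}ᶜ))
  · have h := (hasDerivAt_iff_tendsto_slope.1 hp2).div_const 2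
    refine (h.congr fun s => ?_).trans_eq ?_
    · simp [slope_def_field]
      ring
    · simp

end Calculus

lemma bubble_rpow_eq {γ c₀ l : ℝ} (hγ : γ < 2) (hc₀ : 0 < c₀) (hl : 0 < l) (a u : ℝ × ℝ × ℝ) :
    bubble γ c₀ a l u ^ (4 / (2 - γ)) = c₀ ^ (4 / (2 - γ)) * l ^ 4 /
      ((1 + l ^ 2 * ((u.1 - a.1) ^ 2 + (u.2.1 - a.2.1) ^ 2)) ^ 2
        + l ^ 4 * (u.2.2 - a.2.2 + 2 * (a.1 * u.2.1 - u.1 * a.2.1)) ^ 2) ^ 2 := by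
  have h2 : (2 : ℝ) - γ ≠ 0 := by linarith
  unfold bubble
  set B := (1 + l ^ 2 * ((u.1 - a.1) ^ 2 + (u.2.1 - a.2.1) ^ 2)) ^ 2
        + l ^ 4 * (u.2.2 - a.2.2 + 2 * (a.1 * u.2.1 - u.1 * a.2.1)) ^ 2
  have hB : 0 < B := by positivity
  rw [Real.mul_rpow (by positivity) (by positivity), Real.mul_rpow (by positivity) (by positivity),
    ← Real.rpow_mul hl.le, ← Real.rpow_mul hB.le]
  have e1 : (2 - γ) * (4 / (2 - γ)) = (4 : ℕ) := by field_simp; norm_num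
  have e2 : -(2 - γ) / 2 * (4 / (2 - γ)) = -(2 : ℕ) := by field_simp; norm_num
  rw [e1, e2, Real.rpow_neg hB.le, Real.rpow_natCast, Real.rpow_natCast, ← div_eq_mul_inv]

lemma mul_integral_bubble_eq {γ c₀ l : ℝ} (hγ : γ < 2) (hc₀ : 0 < c₀) (hl : 0 < l)
    {f : ℝ × ℝ × ℝ → ℝ} (hf : Continuous f) (a : ℝ × ℝ × ℝ) :
    l ^ 2 * ∫ u : ℝ × ℝ × ℝ, (f u - f a) * bubble γ c₀ a l u ^ (4 / (2 - γ)) =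
      c₀ ^ (4 / (2 - γ)) * (l ^ 2 * ∫ p : ℝ × ℝ × ℝ,
        (f (a + l⁻¹ • (p.1, p.2.1, 2 * (a.2.1 * p.1 - a.1 * p.2.1))
          + l⁻¹ ^ 2 • (0, 0, p.2.2)) - f a) * bubbleKernel p) := by
  simp_rw [bubble_rpow_eq hγ hc₀ hl a]
  rw [integral_comp_heisenberg a hl]
  · rw [← integral_const_mul, ← integral_const_mul, ← integral_const_mul, ← integral_const_mul]
    congr 1
    ext p
    have hB := (bubbleKernel_denom_pos p).ne'
    have e : (1 + l ^ 2 * (((a + l⁻¹ • (p.1, p.2.1, 2 * (a.2.1 * p.1 - a.1 * p.2.1))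
          + l⁻¹ ^ 2 • ((0 : ℝ), (0 : ℝ), p.2.2)).1 - a.1) ^ 2 +
          ((a + l⁻¹ • (p.1, p.2.1, 2 * (a.2.1 * p.1 - a.1 * p.2.1))
          + l⁻¹ ^ 2 • ((0 : ℝ), (0 : ℝ), p.2.2)).2.1 - a.2.1) ^ 2)) ^ 2
        + l ^ 4 * ((a + l⁻¹ • (p.1, p.2.1, 2 * (a.2.1 * p.1 - a.1 * p.2.1))
          + l⁻¹ ^ 2 • ((0 : ℝ), (0 : ℝ), p.2.2)).2.2 - a.2.2 +
          2 * (a.1 * (a + l⁻¹ • (p.1, p.2.1, 2 * (a.2.1 * p.1 - a.1 * p.2.1))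
          + l⁻¹ ^ 2 • ((0 : ℝ), (0 : ℝ), p.2.2)).2.1 -
          (a + l⁻¹ • (p.1, p.2.1, 2 * (a.2.1 * p.1 - a.1 * p.2.1))
          + l⁻¹ ^ 2 • ((0 : ℝ), (0 : ℝ), p.2.2)).1 * a.2.1)) ^ 2 =
        (1 + p.1 ^ 2 + p.2.1 ^ 2) ^ 2 + p.2.2 ^ 2 := by
      simp
      field_simp
      ring
    rw [e, bubbleKernel]
    field_simp
  · refine Continuous.mul (by fun_prop) (Continuous.div (by fun_prop) (by fun_prop) fun u => ?_)
    positivity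

lemma norm_horizontal_sq_le (a p : ℝ × ℝ × ℝ) :
    ‖(p.1, p.2.1, 2 * (a.2.1 * p.1 - a.1 * p.2.1))‖ ^ 2 ≤
      (1 + 4 * (a.1 ^ 2 + a.2.1 ^ 2)) * (p.1 ^ 2 + p.2.1 ^ 2) := by
  obtain ⟨x, y, t⟩ := p
  obtain ⟨b, c, d⟩ := a
  have hR : 0 ≤ (1 + 4 * (b ^ 2 + c ^ 2)) * (x ^ 2 + y ^ 2) := by positivity
  have hb : ‖((x, y, 2 * (c * x - b * y)) : ℝ × ℝ × ℝ)‖ ≤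
      √((1 + 4 * (b ^ 2 + c ^ 2)) * (x ^ 2 + y ^ 2)) := by
    simp only [Prod.norm_def, sup_le_iff, Real.norm_eq_abs]
    refine ⟨Real.abs_le_sqrt ?_, Real.abs_le_sqrt ?_, Real.abs_le_sqrt ?_⟩
    · nlinarith [sq_nonneg y, mul_nonneg (add_nonneg (sq_nonneg b) (sq_nonneg c))
        (add_nonneg (sq_nonneg x) (sq_nonneg y))]
    · nlinarith [sq_nonneg x, mul_nonneg (add_nonneg (sq_nonneg b) (sq_nonneg c))
        (add_nonneg (sq_nonneg x) (sq_nonneg y))]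
    · nlinarith [sq_nonneg (b * x + c * y), sq_nonneg x, sq_nonneg y]
  calc _ ≤ √((1 + 4 * (b ^ 2 + c ^ 2)) * (x ^ 2 + y ^ 2)) ^ 2 := by gcongr
    _ = _ := Real.sq_sqrt hR

lemma integral_sub_mul_bubbleKernel_eq {f : ℝ × ℝ × ℝ → ℝ} (hf : Continuous f) {C : ℝ}
    (hC : ∀ p, |f p| ≤ C) (a : ℝ × ℝ × ℝ) (l : ℝ) :
    l ^ 2 * ∫ p : ℝ × ℝ × ℝ,
        (f (a + l⁻¹ • (p.1, p.2.1, 2 * (a.2.1 * p.1 - a.1 * p.2.1))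
          + l⁻¹ ^ 2 • (0, 0, p.2.2)) - f a) * bubbleKernel p =
      (1 / 2) * ∫ p : ℝ × ℝ × ℝ, l ^ 2 *
        (f (a + l⁻¹ • (p.1, p.2.1, 2 * (a.2.1 * p.1 - a.1 * p.2.1))
            + l⁻¹ ^ 2 • (0, 0, p.2.2)) +
          f (a + l⁻¹ • (-(p.1, p.2.1, 2 * (a.2.1 * p.1 - a.1 * p.2.1)))
            + l⁻¹ ^ 2 • (0, 0, p.2.2)) - 2 * f a) * bubbleKernel p := by
  set F : ℝ × ℝ × ℝ → ℝ := fun p =>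
    (f (a + l⁻¹ • (p.1, p.2.1, 2 * (a.2.1 * p.1 - a.1 * p.2.1))
          + l⁻¹ ^ 2 • (0, 0, p.2.2)) - f a) with hF
  have hFc : Continuous F := by fun_prop
  have hFC : ∀ p, |F p| ≤ 2 * C := fun p => by
    have h1 := hC (a + l⁻¹ • (p.1, p.2.1, 2 * (a.2.1 * p.1 - a.1 * p.2.1))
          + l⁻¹ ^ 2 • (0, 0, p.2.2))
    have h2 := hC a
    exact (abs_sub _ _).trans (by linarith)
  have hC0 : 0 ≤ C := (abs_nonneg _).trans (hC a)
  have hone : ∀ p : ℝ × ℝ × ℝ, 2 * C ≤ 2 * C * (1 + p.1 ^ 2 + p.2.1 ^ 2 + |p.2.2|) := fun p =>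
    le_mul_of_one_le_right (by positivity)
      (by nlinarith [sq_nonneg p.1, sq_nonneg p.2.1, abs_nonneg p.2.2])
  have hi : Integrable fun p => F p * bubbleKernel p :=
    integrable_mul_bubbleKernel hFc fun p => (hFC p).trans (hone p)
  have hi' : Integrable fun p : ℝ × ℝ × ℝ => F (-p.1, -p.2.1, p.2.2) * bubbleKernel p :=
    integrable_mul_bubbleKernel (hFc.comp (by fun_prop)) fun p => (hFC _).trans (hone p)
  have hsymm : ∫ p : ℝ × ℝ × ℝ, F (-p.1, -p.2.1, p.2.2) * bubbleKernel p =
      ∫ p, F p * bubbleKernel p := by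
    rw [← integral_comp_neg_neg (g := fun p => F p * bubbleKernel p)
      (hFc.mul continuous_bubbleKernel)]
    simp [bubbleKernel]
  have hsplit : ∫ p : ℝ × ℝ × ℝ, l ^ 2 *
        (f (a + l⁻¹ • (p.1, p.2.1, 2 * (a.2.1 * p.1 - a.1 * p.2.1))
            + l⁻¹ ^ 2 • (0, 0, p.2.2)) +
          f (a + l⁻¹ • (-(p.1, p.2.1, 2 * (a.2.1 * p.1 - a.1 * p.2.1)))
            + l⁻¹ ^ 2 • (0, 0, p.2.2)) - 2 * f a) * bubbleKernel p =
      l ^ 2 * ((∫ p, F p * bubbleKernel p) +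
        ∫ p : ℝ × ℝ × ℝ, F (-p.1, -p.2.1, p.2.2) * bubbleKernel p) := by
    rw [← integral_add hi hi', ← integral_const_mul]
    congr 1
    ext p
    have e : (-(p.1, p.2.1, 2 * (a.2.1 * p.1 - a.1 * p.2.1)) : ℝ × ℝ × ℝ) =
        (-p.1, -p.2.1, 2 * (a.2.1 * -p.1 - a.1 * -p.2.1)) := by
      simp only [Prod.neg_mk]; ring_nf
    simp only [hF, e]
    ring
  rw [hsplit, hsymm]
  ring

lemma integral_quadratic_mul_bubbleKernel (α β δ τ : ℝ) :
    ∫ p : ℝ × ℝ × ℝ, (p.1 ^ 2 * α + p.1 * p.2.1 * β + p.2.1 ^ 2 * δ + p.2.2 * τ) *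
        bubbleKernel p =
      (α + δ) / 2 * ∫ p : ℝ × ℝ × ℝ, (p.1 ^ 2 + p.2.1 ^ 2) * bubbleKernel p := by
  have i1 : Integrable fun p : ℝ × ℝ × ℝ => p.1 ^ 2 * bubbleKernel p :=
    integrable_mul_bubbleKernel (C := 1) (by fun_prop) fun p => by
      rw [abs_of_nonneg (sq_nonneg _)]; nlinarith [sq_nonneg p.2.1, abs_nonneg p.2.2]
  have i2 : Integrable fun p : ℝ × ℝ × ℝ => p.2.1 ^ 2 * bubbleKernel p :=
    integrable_mul_bubbleKernel (C := 1) (by fun_prop) fun p => by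
      rw [abs_of_nonneg (sq_nonneg _)]; nlinarith [sq_nonneg p.1, abs_nonneg p.2.2]
  have i3 : Integrable fun p : ℝ × ℝ × ℝ => p.1 * p.2.1 * bubbleKernel p :=
    integrable_mul_bubbleKernel (C := 1) (by fun_prop) fun p => by
      rw [abs_le]
      constructor <;>
        nlinarith [sq_nonneg (p.1 + p.2.1), sq_nonneg (p.1 - p.2.1), abs_nonneg p.2.2]
  have i4 : Integrable fun p : ℝ × ℝ × ℝ => p.2.2 * bubbleKernel p :=
    integrable_mul_bubbleKernel (C := 1) (by fun_prop) fun p => by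
      nlinarith [sq_nonneg p.1, sq_nonneg p.2.1]
  have h12 : ∫ p : ℝ × ℝ × ℝ, p.2.1 ^ 2 * bubbleKernel p =
      ∫ p : ℝ × ℝ × ℝ, p.1 ^ 2 * bubbleKernel p := by
    rw [← integral_comp_swap_fst_snd (g := fun p : ℝ × ℝ × ℝ => p.1 ^ 2 * bubbleKernel p)
      (Continuous.mul (by fun_prop) continuous_bubbleKernel)]
    simp [bubbleKernel, add_right_comm]
  have h3 : ∫ p : ℝ × ℝ × ℝ, p.1 * p.2.1 * bubbleKernel p = 0 := by
    have h := integral_comp_neg_fst (g := fun p : ℝ × ℝ × ℝ => p.1 * p.2.1 * bubbleKernel p)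
      (Continuous.mul (by fun_prop) continuous_bubbleKernel)
    have e : ∀ p : ℝ × ℝ × ℝ, -p.1 * p.2.1 * bubbleKernel (-p.1, p.2.1, p.2.2) =
        -(p.1 * p.2.1 * bubbleKernel p) := fun p => by simp [bubbleKernel]
    simp only [e, integral_neg] at h
    linarith
  have h4 : ∫ p : ℝ × ℝ × ℝ, p.2.2 * bubbleKernel p = 0 := by
    have h := integral_comp_neg_snd_snd (g := fun p : ℝ × ℝ × ℝ => p.2.2 * bubbleKernel p)
      (Continuous.mul (by fun_prop) continuous_bubbleKernel)
    have e : ∀ p : ℝ × ℝ × ℝ, -p.2.2 * bubbleKernel (p.1, p.2.1, -p.2.2) =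
        -(p.2.2 * bubbleKernel p) := fun p => by simp [bubbleKernel]
    simp only [e, integral_neg] at h
    linarith
  have hL : ∫ p : ℝ × ℝ × ℝ, (p.1 ^ 2 * α + p.1 * p.2.1 * β + p.2.1 ^ 2 * δ + p.2.2 * τ) *
        bubbleKernel p =
      α * (∫ p : ℝ × ℝ × ℝ, p.1 ^ 2 * bubbleKernel p) +
      β * (∫ p : ℝ × ℝ × ℝ, p.1 * p.2.1 * bubbleKernel p) +
      δ * (∫ p : ℝ × ℝ × ℝ, p.2.1 ^ 2 * bubbleKernel p) +
      τ * ∫ p : ℝ × ℝ × ℝ, p.2.2 * bubbleKernel p := by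
    have i13 := (i1.const_mul α).add (i3.const_mul β)
    have i132 := i13.add (i2.const_mul δ)
    have h13 := integral_add (i1.const_mul α) (i3.const_mul β)
    have h132 := integral_add i13 (i2.const_mul δ)
    have h1324 := integral_add i132 (i4.const_mul τ)
    simp only [Pi.add_apply, integral_const_mul] at h13 h132 h1324
    rw [h132, h13] at h1324
    rw [← h1324]
    congr 1
    ext p
    ring
  have hR : ∫ p : ℝ × ℝ × ℝ, (p.1 ^ 2 + p.2.1 ^ 2) * bubbleKernel p =
      2 * ∫ p : ℝ × ℝ × ℝ, p.1 ^ 2 * bubbleKernel p := by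
    simp only [add_mul]
    rw [integral_add i1 i2, h12, two_mul]
  rw [hL, hR, h12, h3, h4]
  ring

lemma subLap_eq {f : ℝ × ℝ × ℝ → ℝ} (hf : ContDiff ℝ 2 f) (a : ℝ × ℝ × ℝ) :
    subLap f a = (1 / 4) *
      (fderiv ℝ (fderiv ℝ f) a (1, 0, 2 * a.2.1) (1, 0, 2 * a.2.1) +
        fderiv ℝ (fderiv ℝ f) a (0, 1, -(2 * a.1)) (0, 1, -(2 * a.1))) := by
  have hd2 : HasFDerivAt (fderiv ℝ f) (fderiv ℝ (fderiv ℝ f) a) a :=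
    ((hf.fderiv_right (m := 1) (by norm_num)).differentiable (by norm_num) a).hasFDerivAt
  let S : (ℝ × ℝ × ℝ) →L[ℝ] ℝ :=
    (ContinuousLinearMap.fst ℝ ℝ ℝ).comp (ContinuousLinearMap.snd ℝ ℝ (ℝ × ℝ))
  have hX : HasFDerivAt (fun p : ℝ × ℝ × ℝ => ((1 : ℝ), (0 : ℝ), 2 * p.2.1))
      ((0 : (ℝ × ℝ × ℝ) →L[ℝ] ℝ).prod ((0 : (ℝ × ℝ × ℝ) →L[ℝ] ℝ).prod ((2 : ℝ) • S))) a :=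
    (hasFDerivAt_const _ _).prodMk
      ((hasFDerivAt_const _ _).prodMk (S.hasFDerivAt.const_mul 2))
  have hY : HasFDerivAt (fun p : ℝ × ℝ × ℝ => ((0 : ℝ), (1 : ℝ), -(2 * p.1)))
      ((0 : (ℝ × ℝ × ℝ) →L[ℝ] ℝ).prod ((0 : (ℝ × ℝ × ℝ) →L[ℝ] ℝ).prod
        (-((2 : ℝ) • ContinuousLinearMap.fst ℝ ℝ (ℝ × ℝ))))) a :=
    (hasFDerivAt_const _ _).prodMk
      ((hasFDerivAt_const _ _).prodMk (hasFDerivAt_fst.const_mul 2).neg)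
  have h1 : Xop (Xop f) a = fderiv ℝ (fderiv ℝ f) a (1, 0, 2 * a.2.1) (1, 0, 2 * a.2.1) := by
    have h := (hd2.clm_apply hX).fderiv
    change fderiv ℝ (fun p => fderiv ℝ f p (1, 0, 2 * p.2.1)) a _ = _
    rw [h]
    simp [S, ← Prod.zero_eq_mk]
  have h2 : Yop (Yop f) a =
      fderiv ℝ (fderiv ℝ f) a (0, 1, -(2 * a.1)) (0, 1, -(2 * a.1)) := by
    have h := (hd2.clm_apply hY).fderiv
    change fderiv ℝ (fun p => fderiv ℝ f p (0, 1, -(2 * p.1))) a _ = _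
    rw [h]
    simp [← Prod.zero_eq_mk]
  rw [subLap, h1, h2]

/-- `lim_{λ→∞} λ²·∫ (f(u) − f(a))·δ_{a,λ}(u)^{4/(2−γ)} du = (c₂/4)·Δ_{θ₀}f(a)`. -/
theorem bubble_concentration_subLaplacian (γ : ℝ) (hγ : γ ∈ Set.Ioo (0 : ℝ) 1)
    (c₀ : ℝ) (hc₀ : 0 < c₀) (f : ℝ × ℝ × ℝ → ℝ) (hf : ContDiff ℝ 2 f)
    (hbd : ∃ C : ℝ, ∀ p : ℝ × ℝ × ℝ,
      |f p| ≤ C ∧ ‖fderiv ℝ f p‖ ≤ C ∧ ‖fderiv ℝ (fderiv ℝ f) p‖ ≤ C)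
    (a : ℝ × ℝ × ℝ) :
    Filter.Tendsto
      (fun l : ℝ =>
        l ^ 2 * ∫ u : ℝ × ℝ × ℝ, (f u - f a) * bubble γ c₀ a l u ^ (4 / (2 - γ)))
      Filter.atTop (nhds (c2const γ c₀ / 4 * subLap f a)) := by
  obtain ⟨C, hC⟩ := hbd
  have hC0 : 0 ≤ C := (abs_nonneg _).trans (hC a).1
  set H := fderiv ℝ (fderiv ℝ f) a with hH
  set V : ℝ × ℝ × ℝ := (1, 0, 2 * a.2.1) with hV
  set W : ℝ × ℝ × ℝ := (0, 1, -(2 * a.1)) with hW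
  set w : ℝ × ℝ × ℝ → ℝ × ℝ × ℝ := fun p =>
    (p.1, p.2.1, 2 * (a.2.1 * p.1 - a.1 * p.2.1)) with hw
  have hwVW : ∀ p, w p = p.1 • V + p.2.1 • W := fun p => by
    ext <;> simp [hw, hV, hW]; ring
  have hlim : Filter.Tendsto (fun l : ℝ => ∫ p : ℝ × ℝ × ℝ, l ^ 2 *
        (f (a + l⁻¹ • w p + l⁻¹ ^ 2 • (0, 0, p.2.2)) +
          f (a + l⁻¹ • (-w p) + l⁻¹ ^ 2 • (0, 0, p.2.2)) - 2 * f a) * bubbleKernel p)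
      Filter.atTop (nhds (∫ p : ℝ × ℝ × ℝ,
        (H (w p) (w p) + 2 * fderiv ℝ f a (0, 0, p.2.2)) * bubbleKernel p)) := by
    refine tendsto_integral_filter_of_dominated_convergence
      (fun p => C * (1 + 4 * (a.1 ^ 2 + a.2.1 ^ 2) + 2) *
        ((1 + p.1 ^ 2 + p.2.1 ^ 2 + |p.2.2|) * bubbleKernel p)) ?_ ?_
      (integrable_weighted_bubbleKernel.const_mul _) ?_
    · have := hf.continuous
      exact .of_forall fun l => (Continuous.mul (by fun_prop)
        continuous_bubbleKernel).aestronglyMeasurable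
    · filter_upwards [Filter.eventually_gt_atTop 0] with l hl
      refine .of_forall fun p => ?_
      rw [norm_mul, Real.norm_of_nonneg (bubbleKernel_nonneg p), ← mul_assoc]
      refine mul_le_mul_of_nonneg_right ?_ (bubbleKernel_nonneg p)
      have h1 := abs_parabolic_difference_le hf (fun p => (hC p).2.1) (fun p => (hC p).2.2)
        a (w p) (0, 0, p.2.2) l⁻¹
      have h2 : ‖((0, 0, p.2.2) : ℝ × ℝ × ℝ)‖ = |p.2.2| := by simp [Prod.norm_def]
      rw [h2] at h1
      rw [norm_mul, Real.norm_of_nonneg (sq_nonneg l), Real.norm_eq_abs]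
      calc _ ≤ l ^ 2 * (l⁻¹ ^ 2 * (C * (‖w p‖ ^ 2 + 2 * |p.2.2|))) := by gcongr
        _ = C * (‖w p‖ ^ 2 + 2 * |p.2.2|) := by field_simp
        _ ≤ C * ((1 + 4 * (a.1 ^ 2 + a.2.1 ^ 2) + 2) *
            (1 + p.1 ^ 2 + p.2.1 ^ 2 + |p.2.2|)) := by
          gcongr
          have h3 := norm_horizontal_sq_le a p
          have h4 : 0 ≤ (1 + 4 * (a.1 ^ 2 + a.2.1 ^ 2)) * (1 + |p.2.2|) := by positivity
          nlinarith [sq_nonneg p.1, sq_nonneg p.2.1, abs_nonneg p.2.2]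
        _ = _ := by ring
    · refine .of_forall fun p => Filter.Tendsto.mul_const _ ?_
      have hinv : Filter.Tendsto (fun l : ℝ => l⁻¹) Filter.atTop (nhdsWithin 0 {0}ᶜ) :=
        tendsto_inv_atTop_nhdsGT_zero.mono_right
          (nhdsWithin_mono _ fun x hx => (Set.mem_Ioi.1 hx).ne')
      refine ((tendsto_parabolic_difference hf a (w p) (0, 0, p.2.2)).comp hinv).congr fun l => ?_
      simp only [Function.comp_apply, inv_pow, div_inv_eq_mul]
      ring
  have hval : ∫ p : ℝ × ℝ × ℝ,
        (H (w p) (w p) + 2 * fderiv ℝ f a (0, 0, p.2.2)) * bubbleKernel p =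
      (H V V + H W W) / 2 * ∫ p : ℝ × ℝ × ℝ, (p.1 ^ 2 + p.2.1 ^ 2) * bubbleKernel p := by
    rw [← integral_quadratic_mul_bubbleKernel (H V V) (H V W + H W V) (H W W)
      (2 * fderiv ℝ f a (0, 0, 1))]
    congr 1
    ext p
    have e : ((0, 0, p.2.2) : ℝ × ℝ × ℝ) = p.2.2 • (0, 0, 1) := by simp
    rw [hwVW, e]
    simp only [map_add, map_smul, add_apply, smul_apply,
      smul_eq_mul]
    ring
  have hfinal : c2const γ c₀ / 4 * subLap f a = c₀ ^ (4 / (2 - γ)) * ((1 / 2) *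
      ((H V V + H W W) / 2 * ∫ p : ℝ × ℝ × ℝ, (p.1 ^ 2 + p.2.1 ^ 2) * bubbleKernel p)) := by
    simp only [subLap_eq hf, c2const, bubbleKernel, mul_one_div]
    ring
  rw [hfinal, ← hval]
  refine ((hlim.const_mul (1 / 2)).const_mul (c₀ ^ (4 / (2 - γ)))).congr' ?_
  filter_upwards [Filter.eventually_gt_atTop 0] with l hl
  rw [mul_integral_bubble_eq (by linarith [hγ.2]) hc₀ hl hf.continuous a,
    integral_sub_mul_bubbleKernel_eq hf.continuous (fun p => (hC p).1) a l]
end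

section
/- There exist constants ε₀ ∈ (0,1) and C > 0 (depending only on γ and c₀) such that for all a_i, a_j, a_k ∈ ℝ³ and λ_i, λ_j, λ_k > 0 with ε_ij ≤ ε₀ and ε_ik ≤ ε₀, ∫_{ℝ³} δ_{a_i,λ_i}(u)^{2γ/(2−γ)}·min(δ_{a_i,λ_i}(u), δ_{a_k,λ_k}(u))·δ_{a_j,λ_j}(u) du ≤ C·( ε_ij^{2/(2−γ)}·log(1/ε_ij) + ε_ik^{2/(2−γ)}·log(1/ε_ik) ). -/
open MeasureTheory Real

lemma mul_rpow_interpolation_le {g a b c m : ℝ} (hg0 : 0 < g) (hg1 : g < 1) (ha : 0 < a) (hb : 0 < b)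
    (hc : 0 < c) (hm0 : 0 < m) (hma : m ≤ a) (hmc : m ≤ c) :
    a ^ (2 * g / (2 - g)) * m * b
      ≤ (a * b) ^ (2 / (2 - g)) + (a * c) ^ (2 / (2 - g)) := by
  have hp : 0 < 2 - g := by linarith
  have key : ∀ v w : ℝ, 0 < v → 0 < w → w ≤ v → w ≤ a →
      a ^ (2 * g / (2 - g)) * w * v ≤ (a * v) ^ (2 / (2 - g)) := by
    intro v w hv hw h1 h2
    have e1 : w = w ^ (g / (2 - g)) * w ^ ((2 - 2 * g) / (2 - g)) := by
      rw [← rpow_add hw, ← add_div, show g + (2 - 2 * g) = 2 - g by ring, div_self hp.ne', rpow_one]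
    have e2 : w ^ (g / (2 - g)) ≤ v ^ (g / (2 - g)) :=
      rpow_le_rpow hw.le h1 (by positivity)
    have e3 : w ^ ((2 - 2 * g) / (2 - g)) ≤ a ^ ((2 - 2 * g) / (2 - g)) :=
      rpow_le_rpow hw.le h2 (div_nonneg (by linarith) hp.le)
    have e4 : w ≤ v ^ (g / (2 - g)) * a ^ ((2 - 2 * g) / (2 - g)) := by
      calc w = _ := e1
        _ ≤ _ := by gcongr
    calc a ^ (2 * g / (2 - g)) * w * v
        ≤ a ^ (2 * g / (2 - g)) * (v ^ (g / (2 - g)) * a ^ ((2 - 2 * g) / (2 - g))) * v := by gcongr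
      _ = (a ^ (2 * g / (2 - g)) * a ^ ((2 - 2 * g) / (2 - g))) * (v ^ (g / (2 - g)) * v ^ (1 : ℝ)) := by
          rw [rpow_one]; ring
      _ = (a * v) ^ (2 / (2 - g)) := by
          rw [← rpow_add ha, ← rpow_add hv, mul_rpow ha.le hv.le]
          congr 2 <;> field_simp <;> ring
  have hA : 0 < a ^ (2 * g / (2 - g)) := by positivity
  have h1 : 0 < (a * b) ^ (2 / (2 - g)) := by positivity
  have h2 : 0 < (a * c) ^ (2 / (2 - g)) := by positivity
  rcases le_total m b with h | h
  · linarith [key b m hb hm0 h hma]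
  · have := key c b hc hb (h.trans hmc) (h.trans hma)
    have : a ^ (2 * g / (2 - g)) * m * b ≤ a ^ (2 * g / (2 - g)) * b * c := by
      rw [mul_assoc, mul_assoc, mul_comm b c]; gcongr
    linarith

lemma lintegral_rpow_add_abs_le {A l q : ℝ} (hA : 0 < A) (hl : 0 < l) (hq : 1 < q) (c : ℝ) :
    ∫⁻ t : ℝ, ENNReal.ofReal ((A + l * |t - c|) ^ (-q))
      ≤ ENNReal.ofReal (2 / (l * (q - 1)) * A ^ (-(q - 1))) := by
  rw [lintegral_sub_right_eq_self (fun t : ℝ => ENNReal.ofReal ((A + l * |t|) ^ (-q))) c]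
  have hpos : ∀ t : ℝ, 0 ≤ t → 0 < A + l * t := fun t ht => by positivity
  have hd : ∀ x ∈ Set.Ici (0 : ℝ), HasDerivAt (fun t => -(1 / (l * (q - 1))) * (A + l * t) ^ (-(q - 1)))
      ((A + l * x) ^ (-q)) x := by
    intro x hx
    have h1 : HasDerivAt (fun t => A + l * t) l x := by
      simpa using ((hasDerivAt_id x).const_mul l).const_add A
    have h2 := (h1.rpow_const (p := -(q - 1)) (Or.inl (hpos x hx).ne')).const_mul (-(1 / (l * (q - 1))))
    convert! h2 using 1
    rw [show -(q - 1) - 1 = -q by ring]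
    have : q - 1 ≠ 0 := by linarith
    field_simp
  have ht : Filter.Tendsto (fun t => -(1 / (l * (q - 1))) * (A + l * t) ^ (-(q - 1))) Filter.atTop
      (nhds (-(1 / (l * (q - 1))) * 0)) := by
    refine Filter.Tendsto.const_mul _ ((tendsto_rpow_neg_atTop (by linarith)).comp ?_)
    exact Filter.tendsto_atTop_add_const_left _ _ (Filter.tendsto_id.const_mul_atTop hl)
  have hi := integral_Ioi_of_hasDerivAt_of_nonneg' hd
    (fun x hx => (rpow_pos_of_pos (hpos x (le_of_lt hx)) _).le) ht
  have hbound : Integrable (fun t : ℝ => (A + l * |t|) ^ (-q)) := by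
    by_contra hn
    have h0 := integral_undef hn
    rw [integral_comp_abs (f := fun t => (A + l * t) ^ (-q)), hi] at h0
    have h1 : 0 < 1 / (l * (q - 1)) * A ^ (-(q - 1)) :=
      mul_pos (one_div_pos.2 (mul_pos hl (by linarith))) (rpow_pos_of_pos hA _)
    simp only [mul_zero, add_zero] at h0
    linarith
  rw [← ofReal_integral_eq_lintegral_ofReal hbound (Filter.Eventually.of_forall fun t => by positivity)]
  rw [integral_comp_abs (f := fun t => (A + l * t) ^ (-q)), hi]
  apply ENNReal.ofReal_le_ofReal
  simp only [mul_zero, add_zero]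
  apply le_of_eq; ring

lemma one_div_sq_mul_sq_le {X Y m θ : ℝ} (hX : 0 < X) (hY : 0 < Y) (hm : 0 < m) (h : m ≤ 3 * (X + Y))
    (h0 : 0 ≤ θ) (h2 : θ ≤ 2) :
    1 / (X ^ 2 * Y ^ 2) ≤ 36 * m ^ (θ - 2) * (X ^ (-(2 + θ)) + Y ^ (-(2 + θ))) := by
  have key : ∀ X Y : ℝ, 0 < X → 0 < Y → m ≤ 3 * (X + Y) → Y ≤ X →
      1 / (X ^ 2 * Y ^ 2) ≤ 36 * m ^ (θ - 2) * Y ^ (-(2 + θ)) := by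
    intro X Y hX hY h hYX
    have h6 : m / 6 ≤ X := by linarith
    have e1 : (m / 6) ^ (2 - θ) * Y ^ θ ≤ X ^ 2 := by
      calc (m / 6) ^ (2 - θ) * Y ^ θ ≤ X ^ (2 - θ) * X ^ θ := by
            gcongr
        _ = X ^ 2 := by rw [← rpow_add hX, ← rpow_natCast]; norm_num
    have e2 : m ^ (2 - θ) ≤ 36 * (m / 6) ^ (2 - θ) := by
      rw [div_rpow hm.le (by norm_num)]
      have : (6 : ℝ) ^ (2 - θ) ≤ 36 := by
        calc (6 : ℝ) ^ (2 - θ) ≤ 6 ^ (2 : ℝ) := by gcongr <;> linarith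
          _ = 36 := by norm_num
      have h' : 0 < (6 : ℝ) ^ (2 - θ) := by positivity
      rw [mul_div_assoc', le_div_iff₀ h', mul_comm]
      gcongr
    have e3 : m ^ (2 - θ) * Y ^ (2 + θ) ≤ 36 * (X ^ 2 * Y ^ 2) := by
      have : Y ^ (2 + θ) = Y ^ θ * Y ^ 2 := by
        rw [← rpow_natCast, ← rpow_add hY, add_comm]; norm_num
      rw [this]
      calc m ^ (2 - θ) * (Y ^ θ * Y ^ 2) ≤ 36 * (m / 6) ^ (2 - θ) * (Y ^ θ * Y ^ 2) := by gcongr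
        _ = 36 * (((m / 6) ^ (2 - θ) * Y ^ θ) * Y ^ 2) := by ring
        _ ≤ _ := by gcongr
    rw [show θ - 2 = -(2 - θ) by ring, rpow_neg hm.le, rpow_neg hY.le]
    have p1 : 0 < m ^ (2 - θ) := by positivity
    have p2 : 0 < Y ^ (2 + θ) := by positivity
    rw [div_le_iff₀ (by positivity), show (36 : ℝ) * (m ^ (2 - θ))⁻¹ * (Y ^ (2 + θ))⁻¹ * (X ^ 2 * Y ^ 2)
      = 36 * (X ^ 2 * Y ^ 2) / (m ^ (2 - θ) * Y ^ (2 + θ)) by field_simp, le_div_iff₀ (by positivity)]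
    linarith
  have p1 : 0 < 36 * m ^ (θ - 2) * X ^ (-(2 + θ)) := by positivity
  have p2 : 0 < 36 * m ^ (θ - 2) * Y ^ (-(2 + θ)) := by positivity
  rcases le_total Y X with h' | h'
  · linarith [key X Y hX hY h h']
  · have := key Y X hY hX (by linarith) h'
    rw [mul_comm (Y ^ 2)] at this
    linarith

/-- A quantity comparable to the gauge `1 + l ^ 2 * d(a, u) ^ 2`, adapted to iterated integration. -/
noncomputable def gaugeWeight (a : ℝ × ℝ × ℝ) (l : ℝ) (u : ℝ × ℝ × ℝ) : ℝ :=
  (1 + l * |u.2.1 - a.2.1| + l * |u.1 - a.1|) ^ 2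
    + l ^ 2 * |u.2.2 - (a.2.2 - 2 * (a.1 * u.2.1 - u.1 * a.2.1))|

lemma gaugeWeight_pos (a : ℝ × ℝ × ℝ) {l : ℝ} (hl : 0 < l) (u : ℝ × ℝ × ℝ) :
    0 < gaugeWeight a l u := by
  unfold gaugeWeight; positivity

lemma lintegral_gaugeWeight_rpow_le (a : ℝ × ℝ × ℝ) {l θ : ℝ} (hl : 0 < l) (hθ : 0 < θ) :
    ∫⁻ u : ℝ × ℝ × ℝ, ENNReal.ofReal (gaugeWeight a l u ^ (-(2 + θ)))
      ≤ ENNReal.ofReal (4 / (θ * l ^ 4)) := by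
  have ht : ∀ x y : ℝ, ∫⁻ t : ℝ, ENNReal.ofReal (gaugeWeight a l (x, y, t) ^ (-(2 + θ)))
      ≤ ENNReal.ofReal (2 / l ^ 2)
        * ENNReal.ofReal (((1 + l * |x - a.1|) + l * |y - a.2.1|) ^ (-(2 + 2 * θ))) := by
    intro x y
    simp only [gaugeWeight]
    refine (lintegral_rpow_add_abs_le (A := (1 + l * |y - a.2.1| + l * |x - a.1|) ^ 2) (l := l ^ 2)
      (q := 2 + θ) (by positivity) (by positivity) (by linarith)
      (a.2.2 - 2 * (a.1 * y - x * a.2.1))).trans ?_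
    rw [← ENNReal.ofReal_mul (by positivity)]
    apply ENNReal.ofReal_le_ofReal
    have hB : 0 < 1 + l * |x - a.1| + l * |y - a.2.1| := by positivity
    rw [show 1 + l * |y - a.2.1| + l * |x - a.1| = 1 + l * |x - a.1| + l * |y - a.2.1| by ring,
      ← rpow_natCast_mul hB.le, show ((2 : ℕ) : ℝ) * -(2 + θ - 1) = -(2 + 2 * θ) by push_cast; ring]
    gcongr
    nlinarith [sq_nonneg l]
  have hy : ∀ x : ℝ, ∫⁻ y : ℝ, ∫⁻ t : ℝ, ENNReal.ofReal (gaugeWeight a l (x, y, t) ^ (-(2 + θ)))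
      ≤ ENNReal.ofReal (2 / l ^ 2) * ENNReal.ofReal (2 / l)
        * ENNReal.ofReal ((1 + l * |x - a.1|) ^ (-(1 + 2 * θ))) := by
    intro x
    refine (lintegral_mono (ht x)).trans ?_
    rw [lintegral_const_mul' _ _ ENNReal.ofReal_ne_top, mul_assoc]
    gcongr
    refine (lintegral_rpow_add_abs_le (A := 1 + l * |x - a.1|) (q := 2 + 2 * θ) (by positivity)
      hl (by linarith) a.2.1).trans ?_
    rw [← ENNReal.ofReal_mul (by positivity)]
    apply ENNReal.ofReal_le_ofReal
    rw [show 2 + 2 * θ - 1 = 1 + 2 * θ by ring]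
    gcongr
    nlinarith
  rw [Measure.volume_eq_prod]
  refine (lintegral_prod_le _).trans ?_
  have hxy : ∀ x : ℝ, ∫⁻ v : ℝ × ℝ, ENNReal.ofReal (gaugeWeight a l (x, v) ^ (-(2 + θ)))
      ≤ ENNReal.ofReal (2 / l ^ 2) * ENNReal.ofReal (2 / l)
        * ENNReal.ofReal ((1 + l * |x - a.1|) ^ (-(1 + 2 * θ))) := by
    intro x
    rw [Measure.volume_eq_prod]
    exact (lintegral_prod_le _).trans (hy x)
  refine (lintegral_mono hxy).trans ?_
  rw [lintegral_const_mul' _ _ (ENNReal.mul_ne_top ENNReal.ofReal_ne_top ENNReal.ofReal_ne_top)]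
  refine (mul_le_mul_right (lintegral_rpow_add_abs_le (q := 1 + 2 * θ) one_pos hl
    (by linarith) a.1) _).trans ?_
  rw [← ENNReal.ofReal_mul (by positivity), ← ENNReal.ofReal_mul (by positivity)]
  apply ENNReal.ofReal_le_ofReal
  rw [one_rpow]
  apply le_of_eq
  rw [show 1 + 2 * θ - 1 = 2 * θ by ring]
  field_simp
  norm_num

lemma bubble_pos (γ : ℝ) {c₀ : ℝ} (hc₀ : 0 < c₀) (a : ℝ × ℝ × ℝ) {l : ℝ} (hl : 0 < l)
    (u : ℝ × ℝ × ℝ) : 0 < bubble γ c₀ a l u := by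
  unfold bubble; positivity

lemma measurable_bubble (γ c₀ : ℝ) (a : ℝ × ℝ × ℝ) (l : ℝ) : Measurable (bubble γ c₀ a l) := by
  unfold bubble; fun_prop

lemma bubble_rpow_le {γ c₀ : ℝ} (hγ : γ < 2) (hc₀ : 0 < c₀) (a : ℝ × ℝ × ℝ) {l : ℝ} (hl : 0 < l)
    (u : ℝ × ℝ × ℝ) :
    bubble γ c₀ a l u ^ (2 / (2 - γ))
      ≤ 10 * c₀ ^ (2 / (2 - γ)) * l ^ 2 / gaugeWeight a l u ^ 2 := by
  have hp : 2 - γ ≠ 0 := by linarith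
  have hW := gaugeWeight_pos a hl u
  unfold bubble
  set P := 1 + l ^ 2 * ((u.1 - a.1) ^ 2 + (u.2.1 - a.2.1) ^ 2) with hP
  set T := u.2.2 - a.2.2 + 2 * (a.1 * u.2.1 - u.1 * a.2.1) with hT
  have hPpos : 0 < P := by positivity
  have hN : 0 < P ^ 2 + l ^ 4 * T ^ 2 := by positivity
  have hWN : gaugeWeight a l u ≤ 3 * P + l ^ 2 * |T| := by
    unfold gaugeWeight
    rw [show u.2.2 - (a.2.2 - 2 * (a.1 * u.2.1 - u.1 * a.2.1)) = T by rw [hT]; ring]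
    gcongr
    rw [hP, ← sq_abs (u.1 - a.1), ← sq_abs (u.2.1 - a.2.1)]
    generalize |u.1 - a.1| = r
    generalize |u.2.1 - a.2.1| = s
    nlinarith [sq_nonneg (1 - l * r), sq_nonneg (1 - l * s), sq_nonneg (l * s - l * r)]
  have hW2 : gaugeWeight a l u ^ 2 ≤ 10 * (P ^ 2 + l ^ 4 * T ^ 2) := by
    calc gaugeWeight a l u ^ 2 ≤ (3 * P + l ^ 2 * |T|) ^ 2 := by gcongr
      _ ≤ 10 * (P ^ 2 + l ^ 4 * |T| ^ 2) := by nlinarith [sq_nonneg (P - 3 * (l ^ 2 * |T|))]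
      _ = _ := by rw [sq_abs]
  rw [mul_rpow (by positivity) (by positivity), mul_rpow (by positivity) (by positivity),
    ← rpow_mul hl.le, ← rpow_mul hN.le, mul_div_cancel₀ _ hp,
    show -(2 - γ) / 2 * (2 / (2 - γ)) = -1 by field_simp, rpow_neg_one, rpow_two]
  rw [le_div_iff₀ (by positivity)]
  calc c₀ ^ (2 / (2 - γ)) * l ^ 2 * (P ^ 2 + l ^ 4 * T ^ 2)⁻¹ * gaugeWeight a l u ^ 2
      ≤ c₀ ^ (2 / (2 - γ)) * l ^ 2 * (P ^ 2 + l ^ 4 * T ^ 2)⁻¹ * (10 * (P ^ 2 + l ^ 4 * T ^ 2)) := by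
        gcongr
    _ = _ := by field_simp

/-- The base of the power defining `epsb`. -/
noncomputable def interactionScale (ai aj : ℝ × ℝ × ℝ) (li lj : ℝ) : ℝ :=
  li / lj + lj / li + li * lj * gdist ai aj ^ 2

lemma gdist_sq_le (a b u : ℝ × ℝ × ℝ) :
    gdist a b ^ 2
      ≤ 3 * ((u.1 - a.1) ^ 2 + (u.2.1 - a.2.1) ^ 2)
          + |u.2.2 - (a.2.2 - 2 * (a.1 * u.2.1 - u.1 * a.2.1))|
        + (3 * ((u.1 - b.1) ^ 2 + (u.2.1 - b.2.1) ^ 2)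
          + |u.2.2 - (b.2.2 - 2 * (b.1 * u.2.1 - u.1 * b.2.1))|) := by
  obtain ⟨x₁, y₁, t₁⟩ := a
  obtain ⟨x₂, y₂, t₂⟩ := b
  obtain ⟨x, y, t⟩ := u
  simp only [gdist]
  rw [← rpow_natCast, ← rpow_mul (by positivity),
    show (1 : ℝ) / 4 * ((2 : ℕ) : ℝ) = 1 / 2 by norm_num, ← sqrt_eq_rpow]
  set τ₁ := t - (t₁ - 2 * (x₁ * y - x * y₁)) with h₁
  set τ₂ := t - (t₂ - 2 * (x₂ * y - x * y₂)) with h₂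
  have hτ : t₁ - t₂ + 2 * x₂ * y₁ - 2 * x₁ * y₂
      = τ₂ - τ₁ - 2 * ((x - x₁) * (y - y₂) - (x - x₂) * (y - y₁)) := by rw [h₁, h₂]; ring
  have hτ' : |t₁ - t₂ + 2 * x₂ * y₁ - 2 * x₁ * y₂|
      ≤ |τ₁| + |τ₂| + (x - x₁) ^ 2 + (y - y₁) ^ 2 + (x - x₂) ^ 2 + (y - y₂) ^ 2 := by
    rw [hτ, abs_le]
    constructor <;>
    nlinarith [neg_abs_le τ₁, neg_abs_le τ₂, le_abs_self τ₁, le_abs_self τ₂,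
      sq_nonneg (x - x₁ - (y - y₂)), sq_nonneg (x - x₁ + (y - y₂)),
      sq_nonneg (x - x₂ - (y - y₁)), sq_nonneg (x - x₂ + (y - y₁))]
  calc √(((x₁ - x₂) ^ 2 + (y₁ - y₂) ^ 2) ^ 2 + (t₁ - t₂ + 2 * x₂ * y₁ - 2 * x₁ * y₂) ^ 2)
      ≤ ((x₁ - x₂) ^ 2 + (y₁ - y₂) ^ 2) + |t₁ - t₂ + 2 * x₂ * y₁ - 2 * x₁ * y₂| := by
        apply sqrt_le_iff.2 ⟨by positivity, ?_⟩
        rw [← sq_abs (t₁ - t₂ + 2 * x₂ * y₁ - 2 * x₁ * y₂)]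
        have : 0 ≤ ((x₁ - x₂) ^ 2 + (y₁ - y₂) ^ 2) * |t₁ - t₂ + 2 * x₂ * y₁ - 2 * x₁ * y₂| := by
          positivity
        nlinarith
    _ ≤ _ := by
        nlinarith [sq_nonneg ((x - x₁) + (x - x₂)), sq_nonneg ((y - y₁) + (y - y₂))]

lemma one_add_le_gaugeWeight (a : ℝ × ℝ × ℝ) {l : ℝ} (hl : 0 < l) (u : ℝ × ℝ × ℝ) :
    1 + l ^ 2 * ((u.1 - a.1) ^ 2 + (u.2.1 - a.2.1) ^ 2
        + |u.2.2 - (a.2.2 - 2 * (a.1 * u.2.1 - u.1 * a.2.1))|) ≤ gaugeWeight a l u := by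
  unfold gaugeWeight
  rw [← sq_abs (u.1 - a.1), ← sq_abs (u.2.1 - a.2.1)]
  have h1 := mul_nonneg hl.le (abs_nonneg (u.1 - a.1))
  have h2 := mul_nonneg hl.le (abs_nonneg (u.2.1 - a.2.1))
  nlinarith [mul_nonneg h1 h2]

lemma interactionScale_le (a b : ℝ × ℝ × ℝ) {l m : ℝ} (hl : 0 < l) (hm : 0 < m) (u : ℝ × ℝ × ℝ) :
    interactionScale a b l m
      ≤ 3 * (m / l * gaugeWeight a l u + l / m * gaugeWeight b m u) := by
  have h := gdist_sq_le a b u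
  have h1 := one_add_le_gaugeWeight a hl u
  have h2 := one_add_le_gaugeWeight b hm u
  unfold interactionScale
  have n1 := abs_nonneg (u.2.2 - (a.2.2 - 2 * (a.1 * u.2.1 - u.1 * a.2.1)))
  have n2 := abs_nonneg (u.2.2 - (b.2.2 - 2 * (b.1 * u.2.1 - u.1 * b.2.1)))
  set S₁ := (u.1 - a.1) ^ 2 + (u.2.1 - a.2.1) ^ 2
  set S₂ := (u.1 - b.1) ^ 2 + (u.2.1 - b.2.1) ^ 2
  set τ₁ := |u.2.2 - (a.2.2 - 2 * (a.1 * u.2.1 - u.1 * a.2.1))|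
  set τ₂ := |u.2.2 - (b.2.2 - 2 * (b.1 * u.2.1 - u.1 * b.2.1))|
  have e1 : m / l * (1 + l ^ 2 * (S₁ + τ₁)) ≤ m / l * gaugeWeight a l u := by gcongr
  have e2 : l / m * (1 + m ^ 2 * (S₂ + τ₂)) ≤ l / m * gaugeWeight b m u := by gcongr
  have e3 : l * m * gdist a b ^ 2 ≤ l * m * (3 * S₁ + τ₁ + (3 * S₂ + τ₂)) := by gcongr
  have e4 : m / l * (1 + l ^ 2 * (S₁ + τ₁)) = m / l + l * m * (S₁ + τ₁) := by field_simp
  have e5 : l / m * (1 + m ^ 2 * (S₂ + τ₂)) = l / m + l * m * (S₂ + τ₂) := by field_simp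
  have p1 : 0 < m / l := by positivity
  have p2 : 0 < l / m := by positivity
  have p3 : 0 ≤ l * m * τ₁ := by positivity
  have p4 : 0 ≤ l * m * τ₂ := by positivity
  nlinarith

lemma two_le_interactionScale (a b : ℝ × ℝ × ℝ) {l m : ℝ} (hl : 0 < l) (hm : 0 < m) :
    2 ≤ interactionScale a b l m := by
  unfold interactionScale
  have h : 2 ≤ l / m + m / l := by
    rw [div_add_div _ _ hm.ne' hl.ne', le_div_iff₀ (by positivity)]
    nlinarith [sq_nonneg (l - m)]
  have : 0 ≤ l * m * gdist a b ^ 2 := by positivity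
  linarith

lemma lintegral_bubble_mul_bubble_rpow_le {γ c₀ : ℝ} (hγ : γ < 2) (hc₀ : 0 < c₀)
    (a b : ℝ × ℝ × ℝ) {l m : ℝ} (hl : 0 < l) (hm : 0 < m) :
    ∫⁻ u : ℝ × ℝ × ℝ, ENNReal.ofReal ((bubble γ c₀ a l u * bubble γ c₀ b m u) ^ (2 / (2 - γ)))
      ≤ ENNReal.ofReal (57600 * exp 1 * (c₀ ^ (2 / (2 - γ))) ^ 2
          * (interactionScale a b l m ^ (-2 : ℝ) * log (interactionScale a b l m))) := by
  set M := interactionScale a b l m with hM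
  have hM2 : 2 ≤ M := two_le_interactionScale a b hl hm
  have hM0 : 0 < M := by linarith
  have hlog : 1 / 2 < log M :=
    lt_of_lt_of_le (by linarith [log_two_gt_d9]) (log_le_log (by norm_num) hM2)
  set K := c₀ ^ (2 / (2 - γ)) with hK
  have hK0 : 0 < K := by positivity
  set θ := 1 / (2 * log M) with hθ
  have hθ0 : 0 < θ := by positivity
  have hθ2 : θ ≤ 2 := by
    rw [hθ, div_le_iff₀ (by positivity)]; linarith
  set D := 3600 * K ^ 2 * l ^ 2 * m ^ 2 * M ^ (θ - 2) with hD
  have hD0 : 0 < D := by positivity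
  have hpt : ∀ u : ℝ × ℝ × ℝ,
      (bubble γ c₀ a l u * bubble γ c₀ b m u) ^ (2 / (2 - γ))
        ≤ D * (m / l) ^ (-(2 + θ)) * gaugeWeight a l u ^ (-(2 + θ))
          + D * (l / m) ^ (-(2 + θ)) * gaugeWeight b m u ^ (-(2 + θ)) := by
    intro u
    have hA := gaugeWeight_pos a hl u
    have hB := gaugeWeight_pos b hm u
    have h1 := one_div_sq_mul_sq_le (X := m / l * gaugeWeight a l u)
      (Y := l / m * gaugeWeight b m u) (by positivity) (by positivity) hM0
      (interactionScale_le a b hl hm u) hθ0.le hθ2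
    rw [mul_rpow (by positivity) hA.le, mul_rpow (by positivity) hB.le] at h1
    rw [mul_rpow (bubble_pos γ hc₀ a hl u).le (bubble_pos γ hc₀ b hm u).le]
    have hb := (bubble_pos γ hc₀ b hm u).le
    calc _ ≤ (10 * K * l ^ 2 / gaugeWeight a l u ^ 2) * (10 * K * m ^ 2 / gaugeWeight b m u ^ 2) := by
          gcongr
          · exact bubble_rpow_le hγ hc₀ a hl u
          · exact bubble_rpow_le hγ hc₀ b hm u
      _ = 100 * K ^ 2 * l ^ 2 * m ^ 2 *
          (1 / ((m / l * gaugeWeight a l u) ^ 2 * (l / m * gaugeWeight b m u) ^ 2)) := by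
          field_simp; norm_num
      _ ≤ 100 * K ^ 2 * l ^ 2 * m ^ 2 * (36 * M ^ (θ - 2) *
          ((m / l) ^ (-(2 + θ)) * gaugeWeight a l u ^ (-(2 + θ))
            + (l / m) ^ (-(2 + θ)) * gaugeWeight b m u ^ (-(2 + θ)))) := by gcongr
      _ = _ := by rw [hD]; ring
  have hmeas : Measurable fun u => ENNReal.ofReal
      (D * (m / l) ^ (-(2 + θ)) * gaugeWeight a l u ^ (-(2 + θ))) := by
    unfold gaugeWeight; fun_prop
  have hbound : ∀ (e : ℝ × ℝ × ℝ) (v w : ℝ), 0 < v → 0 < w → v / w ≤ M →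
      D = 3600 * K ^ 2 * v ^ 2 * w ^ 2 * M ^ (θ - 2) →
      ∫⁻ u, ENNReal.ofReal (D * (w / v) ^ (-(2 + θ)) * gaugeWeight e v u ^ (-(2 + θ)))
        ≤ ENNReal.ofReal (28800 * exp 1 * K ^ 2 * (M ^ (-2 : ℝ) * log M)) := by
    intro e v w hv hw hvM hDe
    have hc : 0 ≤ D * (w / v) ^ (-(2 + θ)) := by positivity
    simp_rw [ENNReal.ofReal_mul hc]
    rw [lintegral_const_mul' _ _ ENNReal.ofReal_ne_top]
    refine (mul_le_mul_right (lintegral_gaugeWeight_rpow_le e hv hθ0) _).trans ?_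
    rw [← ENNReal.ofReal_mul hc]
    apply ENNReal.ofReal_le_ofReal
    have h1 : (w / v) ^ (-(2 + θ)) = (v / w) ^ 2 * (v / w) ^ θ := by
      rw [rpow_neg (by positivity), ← inv_rpow (by positivity), inv_div, rpow_add (by positivity),
        rpow_two]
    have h2 : (v / w) ^ θ ≤ M ^ θ := by gcongr
    have h3 : M ^ (θ - 2) * M ^ θ = exp 1 * M ^ (-2 : ℝ) := by
      rw [← rpow_add hM0, show θ - 2 + θ = 2 * θ + (-2) by ring, rpow_add hM0]
      congr 1
      rw [rpow_def_of_pos hM0]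
      congr 1
      rw [hθ]; field_simp
    calc D * (w / v) ^ (-(2 + θ)) * (4 / (θ * v ^ 4))
        = 14400 * K ^ 2 * M ^ (θ - 2) * (v / w) ^ θ / θ := by
          rw [h1, hDe]; field_simp; norm_num
      _ ≤ 14400 * K ^ 2 * M ^ (θ - 2) * M ^ θ / θ := by gcongr
      _ = 14400 * K ^ 2 * (M ^ (θ - 2) * M ^ θ) / θ := by ring
      _ = _ := by rw [h3, hθ]; field_simp; norm_num
  have hg : 0 ≤ l * m * gdist a b ^ 2 := by positivity
  have hlm : 0 < l / m := by positivity
  have hml : 0 < m / l := by positivity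
  have hMe : M = l / m + m / l + l * m * gdist a b ^ 2 := rfl
  calc _ ≤ ∫⁻ u, (ENNReal.ofReal (D * (m / l) ^ (-(2 + θ)) * gaugeWeight a l u ^ (-(2 + θ)))
          + ENNReal.ofReal (D * (l / m) ^ (-(2 + θ)) * gaugeWeight b m u ^ (-(2 + θ)))) :=
        lintegral_mono fun u => (ENNReal.ofReal_le_ofReal (hpt u)).trans ENNReal.ofReal_add_le
    _ = _ := lintegral_add_left hmeas _
    _ ≤ _ := add_le_add (hbound a l m hl hm (by linarith) hD)
        (hbound b m l hm hl (by linarith) (by rw [hD]; ring))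
    _ = _ := by
        rw [← ENNReal.ofReal_add (by positivity) (by positivity)]
        congr 1; ring

lemma epsb_rpow_mul_log {γ : ℝ} (hγ : γ < 2) (a b : ℝ × ℝ × ℝ) {l m : ℝ} (hl : 0 < l) (hm : 0 < m) :
    epsb γ a b l m ^ (2 / (2 - γ)) * log (1 / epsb γ a b l m)
      = (2 - γ) * (interactionScale a b l m ^ (-2 : ℝ) * log (interactionScale a b l m)) := by
  have hM : 0 < interactionScale a b l m := by linarith [two_le_interactionScale a b hl hm]
  have hp : 2 - γ ≠ 0 := by linarith
  have he : epsb γ a b l m = interactionScale a b l m ^ (-(2 - γ)) := rfl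
  rw [he, ← rpow_mul hM.le, one_div, log_inv, log_rpow hM,
    show -(2 - γ) * (2 / (2 - γ)) = -2 by field_simp]
  ring

/-- Triple-bubble interaction estimate (Lemma B.3.4-type):
`∫ δ_i^{2γ/(2−γ)}·min(δ_i, δ_k)·δ_j ≤ C(ε_ij^{2/(2−γ)} log(1/ε_ij) + ε_ik^{2/(2−γ)} log(1/ε_ik))`. -/
theorem bubble_triple_interaction_estimate (γ : ℝ) (hγ : γ ∈ Set.Ioo (0 : ℝ) 1)
    (c₀ : ℝ) (hc₀ : 0 < c₀) :
    ∃ ε₀ ∈ Set.Ioo (0 : ℝ) 1, ∃ C : ℝ, 0 < C ∧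
      ∀ (ai aj ak : ℝ × ℝ × ℝ) (li lj lk : ℝ), 0 < li → 0 < lj → 0 < lk →
        epsb γ ai aj li lj ≤ ε₀ → epsb γ ai ak li lk ≤ ε₀ →
          (∫ u : ℝ × ℝ × ℝ,
              bubble γ c₀ ai li u ^ (2 * γ / (2 - γ))
                * min (bubble γ c₀ ai li u) (bubble γ c₀ ak lk u)
                * bubble γ c₀ aj lj u)
            ≤ C * (epsb γ ai aj li lj ^ (2 / (2 - γ)) * Real.log (1 / epsb γ ai aj li lj)
                + epsb γ ai ak li lk ^ (2 / (2 - γ)) * Real.log (1 / epsb γ ai ak li lk)) := by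
  obtain ⟨h0, h1⟩ := hγ
  set K := 57600 * exp 1 * (c₀ ^ (2 / (2 - γ))) ^ 2 with hK
  have hp : 0 < 2 - γ := by linarith
  refine ⟨1 / 2, ⟨by norm_num, by norm_num⟩, K / (2 - γ), by positivity, ?_⟩
  intro ai aj ak li lj lk hi hj hk _ _
  have hγ2 : γ < 2 := by linarith
  rw [epsb_rpow_mul_log hγ2 ai aj hi hj, epsb_rpow_mul_log hγ2 ai ak hi hk]
  have hpos := fun a l (hl : 0 < l) u => bubble_pos γ hc₀ a (l := l) hl u
  have hlog : ∀ b m, 0 < m → 0 ≤ log (interactionScale ai b li m) := fun b m hm =>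
    log_nonneg (by linarith [two_le_interactionScale ai b hi hm])
  have hM : ∀ b m, 0 < m → 0 ≤ interactionScale ai b li m ^ (-2 : ℝ) := fun b m hm =>
    rpow_nonneg (by linarith [two_le_interactionScale ai b hi hm]) _
  have hnn : ∀ b m, 0 < m → 0 ≤ K *
      (interactionScale ai b li m ^ (-2 : ℝ) * log (interactionScale ai b li m)) := fun b m hm =>
    mul_nonneg (by positivity) (mul_nonneg (hM b m hm) (hlog b m hm))
  have hbi := measurable_bubble γ c₀ ai li
  have hbj := measurable_bubble γ c₀ aj lj
  have hbk := measurable_bubble γ c₀ ak lk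
  rw [integral_eq_lintegral_of_nonneg_ae
    (Filter.Eventually.of_forall fun u => by
      have := hpos ai li hi u
      have := hpos aj lj hj u
      have := hpos ak lk hk u
      positivity)
    (Measurable.aestronglyMeasurable (by fun_prop))]
  apply ENNReal.toReal_le_of_le_ofReal
  · rw [← mul_add, ← mul_assoc, div_mul_cancel₀ _ hp.ne', mul_add]
    exact add_nonneg (hnn aj lj hj) (hnn ak lk hk)
  rw [← mul_add, ← mul_assoc, div_mul_cancel₀ _ hp.ne', mul_add,
    ENNReal.ofReal_add (hnn aj lj hj) (hnn ak lk hk)]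
  refine le_trans ?_ (add_le_add (lintegral_bubble_mul_bubble_rpow_le hγ2 hc₀ ai aj hi hj)
    (lintegral_bubble_mul_bubble_rpow_le hγ2 hc₀ ai ak hi hk))
  rw [← lintegral_add_left (by fun_prop)]
  refine lintegral_mono fun u => ?_
  refine (ENNReal.ofReal_le_ofReal ?_).trans ENNReal.ofReal_add_le
  exact mul_rpow_interpolation_le h0 h1 (hpos ai li hi u) (hpos aj lj hj u) (hpos ak lk hk u)
    (lt_min (hpos ai li hi u) (hpos ak lk hk u)) (min_le_left _ _) (min_le_right _ _)
end
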